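/- arXiv:1601.04233 — 5 statements merged into one kernel-verified Lean document; each statement's English description precedes it below -/
import Mathlib

section
/- Let p ≥ 1 be an integer, let x_1, …, x_n be nonnegative integers with M = Σ_{i=1}^n x_i > 0, and let S_p = Σ_{i=1}^n C(x_i, p). Then the second moment of the estimator Y (where Y = (M/x_i)·C(x_i, p) on index i drawn with probability x_i/M) satisfies Σ_{i=1}^n (x_i/M)·((M/x_i)·C(x_i, p))^2 ≤ M · S_p^{2 − 1/p}, where any summand with x_i = 0 is interpreted as 0 and the right-hand side uses the real power with exponent 2 − 1/p. -/
/-- The ratio `C(a, p) / a` is at most `C(a, p) ^ (1 - 1 / p)`. -/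
theorem choose_div_le_rpow {p a : ℕ} (hp : p ≠ 0) (ha : 0 < a) (hc : 0 < a.choose p) :
    (a.choose p : ℝ) / a ≤ (a.choose p : ℝ) ^ ((1 : ℝ) - 1 / (p : ℝ)) := by
  have ha' : (0 : ℝ) < a := by exact_mod_cast ha
  have hc' : (0 : ℝ) < a.choose p := by exact_mod_cast hc
  have hroot : (a.choose p : ℝ) ^ (1 / (p : ℝ)) ≤ a := by
    calc (a.choose p : ℝ) ^ (1 / (p : ℝ)) ≤ ((a : ℝ) ^ p) ^ (1 / (p : ℝ)) := by
          gcongr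
          exact_mod_cast Nat.choose_le_pow a p
      _ = a := by rw [one_div, Real.pow_rpow_inv_natCast ha'.le hp]
  rw [Real.rpow_sub hc', Real.rpow_one]
  gcongr

/-- Second moment bound for the unbiased estimator:
`∑_i (x_i / M) * ((M / x_i) * C(x_i, p))² ≤ M * S_p^(2 - 1/p)`
(summands with `x_i = 0` are `0`; the right-hand side uses the real power). -/
theorem star_estimator_second_moment (p n : ℕ) (hp : 1 ≤ p) (x : Fin n → ℕ)
    (M : ℕ) (hM : M = ∑ i, x i) (hMpos : 0 < M)
    (Sp : ℕ) (hSp : Sp = ∑ i, (x i).choose p) :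
    ∑ i, ((x i : ℝ) / (M : ℝ)) * (((M : ℝ) / (x i : ℝ)) * ((x i).choose p : ℝ)) ^ 2
      ≤ (M : ℝ) * (Sp : ℝ) ^ ((2 : ℝ) - 1 / (p : ℝ)) := by
  have hM_pos : (0 : ℝ) < M := by exact_mod_cast hMpos
  have hexp : (0 : ℝ) ≤ 1 - 1 / (p : ℝ) := by
    rw [sub_nonneg, one_div]
    exact Nat.cast_inv_le_one p
  have hterm (i : Fin n) :
      ((x i : ℝ) / M) * (((M : ℝ) / x i) * ((x i).choose p : ℝ)) ^ 2
        ≤ M * (((x i).choose p : ℝ) * (Sp : ℝ) ^ ((1 : ℝ) - 1 / (p : ℝ))) := by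
    rcases Nat.eq_zero_or_pos ((x i).choose p) with hc | hc
    · simp [hc]
    · have hxi : 0 < x i := by
        by_contra! h
        exact hc.ne' (Nat.choose_eq_zero_of_lt (by omega))
      have hxi' : (0 : ℝ) < x i := by exact_mod_cast hxi
      have hcS : (x i).choose p ≤ Sp := by
        rw [hSp]
        exact Finset.single_le_sum (f := fun j => (x j).choose p)
          (fun _ _ => Nat.zero_le _) (Finset.mem_univ i)
      calc ((x i : ℝ) / M) * (((M : ℝ) / x i) * ((x i).choose p : ℝ)) ^ 2
          = M * (((x i).choose p : ℝ) * (((x i).choose p : ℝ) / x i)) := by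
            field_simp
        _ ≤ M * (((x i).choose p : ℝ) * ((x i).choose p : ℝ) ^ ((1 : ℝ) - 1 / (p : ℝ))) := by
            gcongr
            exact choose_div_le_rpow (by omega) hxi hc
        _ ≤ M * (((x i).choose p : ℝ) * (Sp : ℝ) ^ ((1 : ℝ) - 1 / (p : ℝ))) := by
            gcongr
  refine (Finset.sum_le_sum fun i _ => hterm i).trans_eq ?_
  rw [← Finset.mul_sum, ← Finset.sum_mul, ← Nat.cast_sum, ← hSp,
    show (2 : ℝ) - 1 / (p : ℝ) = 1 + (1 - 1 / (p : ℝ)) by ring,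
    Real.rpow_add_of_nonneg (Nat.cast_nonneg Sp) zero_le_one hexp, Real.rpow_one]
end

section
/- Let p ≥ 1 be an integer and let x_1, …, x_n be nonnegative integers. Then Σ_{i : x_i > 0} C(x_i, p)^2 / x_i ≤ (Σ_{i=1}^n C(x_i, p))^{2 − 1/p}, where the right-hand side uses the real power with exponent 2 − 1/p. -/
/-- The pointwise bound `C(d, p)² / d ≤ C(d, p) · C(d, p)^(1 - 1/p)`. -/
theorem choose_sq_div_le_mul_rpow {p d : ℕ} (hp : 1 ≤ p) (hd : 0 < d) :
    (d.choose p : ℝ) ^ 2 / d ≤ d.choose p * (d.choose p : ℝ) ^ (1 - 1 / (p : ℝ)) := by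
  rcases (d.choose p).eq_zero_or_pos with h | h
  · simp [h]
  have hc : (0 : ℝ) < d.choose p := by exact_mod_cast h
  have hroot : (d.choose p : ℝ) ^ (1 / (p : ℝ)) ≤ d := by
    rw [one_div, Real.rpow_inv_le_iff_of_pos hc.le (by positivity) (by positivity),
      Real.rpow_natCast]
    exact_mod_cast Nat.choose_le_pow d p
  rw [sq, mul_div_assoc, Real.rpow_sub hc, Real.rpow_one]
  gcongr

/-- For nonnegative integers `x_1, …, x_n` and `p ≥ 1`,
`∑_{i : x_i > 0} C(x_i, p)² / x_i ≤ (∑_i C(x_i, p))^(2 - 1/p)`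
(the right-hand side uses the real power). -/
theorem choose_sq_div_sum_le (p n : ℕ) (hp : 1 ≤ p) (x : Fin n → ℕ) :
    ∑ i ∈ Finset.univ.filter (fun i => 0 < x i),
        ((x i).choose p : ℝ) ^ 2 / (x i : ℝ)
      ≤ (∑ i, ((x i).choose p : ℝ)) ^ ((2 : ℝ) - 1 / (p : ℝ)) := by
  set S : ℝ := ∑ i, ((x i).choose p : ℝ) with hS
  have hS0 : 0 ≤ S := by positivity
  have hexp : 0 ≤ 1 - 1 / (p : ℝ) := by
    rw [sub_nonneg]
    exact div_le_one_of_le₀ (by exact_mod_cast hp) (by positivity)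
  calc _ ≤ ∑ i ∈ Finset.univ.filter (fun i => 0 < x i),
        ((x i).choose p : ℝ) * S ^ (1 - 1 / (p : ℝ)) := by
        refine Finset.sum_le_sum fun i hi => ?_
        refine (choose_sq_div_le_mul_rpow hp (Finset.mem_filter.1 hi).2).trans ?_
        gcongr
        exact Finset.single_le_sum (f := fun i => ((x i).choose p : ℝ))
          (fun _ _ => by positivity) (Finset.mem_univ i)
    _ ≤ ∑ i, ((x i).choose p : ℝ) * S ^ (1 - 1 / (p : ℝ)) :=
        Finset.sum_le_sum_of_subset_of_nonneg (Finset.filter_subset _ _)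
          fun _ _ _ => by positivity
    _ = S ^ ((2 : ℝ) - 1 / (p : ℝ)) := by
        rw [← Finset.sum_mul, ← hS, ← Real.rpow_one_add' hS0 (by linarith)]
        ring_nf
end

section
/- Let p ≥ 2 be an integer, 0 < ε ≤ 1/2, and let x_1, …, x_n be nonnegative integers with M = Σ_i x_i > 0, m = M/2, and S_p = Σ_{i=1}^n C(x_i, p) > 0. Let μ be the probability measure on {1,…,n} with μ({i}) = x_i/M, and let Y(i) = (M/x_i)·C(x_i, p). Suppose S̃ is a real number with S_p/2 ≤ S̃ ≤ 6·S_p, and let k be a positive integer with k ≥ 36m/(ε²·S̃^{1/p}). If i_1, …, i_k are drawn independently according to μ (i.e., the product measure μ^k on k-tuples of indices) and Ȳ = (1/k)·Σ_{j=1}^k Y(i_j), then the probability that |Ȳ − S_p| ≥ ε·S_p is at most 1/3. -/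
open MeasureTheory

open ProbabilityTheory in
/-- Chebyshev's inequality for the mean of `k` independent samples from a finite probability
space. -/
lemma measure_pi_le_abs_sample_mean_sub_le {Ω : Type*} [MeasurableSpace Ω]
    [DiscreteMeasurableSpace Ω] [Finite Ω] (μ : Measure Ω) [IsProbabilityMeasure μ]
    (Y : Ω → ℝ) {k : ℕ} (hk : 0 < k) {c : ℝ} (hc : 0 < c) :
    (Measure.pi fun _ : Fin k => μ)
        {ω : Fin k → Ω | c ≤ |(1 / (k : ℝ)) * ∑ j, Y (ω j) - ∫ x, Y x ∂μ|}
      ≤ ENNReal.ofReal ((∫ x, Y x ^ 2 ∂μ) / (k * c ^ 2)) := by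
  have hk' : (0 : ℝ) < k := Nat.cast_pos.2 hk
  have hmean : ∫ ω : Fin k → Ω, (1 / (k : ℝ)) * ∑ j, Y (ω j) ∂(Measure.pi fun _ : Fin k => μ)
      = ∫ x, Y x ∂μ := by
    rw [integral_const_mul, integral_finsetSum _ fun j _ => Integrable.of_finite]
    have h (j : Fin k) : ∫ ω : Fin k → Ω, Y (ω j) ∂(Measure.pi fun _ : Fin k => μ)
        = ∫ x, Y x ∂μ :=
      integral_comp_eval (μ := fun _ : Fin k => μ) .of_discrete
    simp only [h, Finset.sum_const, Finset.card_univ, Fintype.card_fin, nsmul_eq_mul]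
    field_simp
  have hvar : variance (fun ω : Fin k → Ω => (1 / (k : ℝ)) * ∑ j, Y (ω j))
      (Measure.pi fun _ : Fin k => μ) = variance Y μ / k := by
    have h := variance_sum_pi (μ := fun _ : Fin k => μ) (X := fun _ => Y) fun _ => .of_discrete
    rw [variance_const_mul]
    simp only [Finset.sum_const, Finset.card_univ, Fintype.card_fin, nsmul_eq_mul] at h
    have h' : (∑ j : Fin k, fun ω : Fin k → Ω => Y (ω j)) = fun ω => ∑ j, Y (ω j) := by
      ext ω
      simp
    rw [h'] at h
    rw [h]
    field_simp
  have hcheb := meas_ge_le_variance_div_sq (μ := Measure.pi fun _ : Fin k => μ)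
    (X := fun ω : Fin k → Ω => (1 / (k : ℝ)) * ∑ j, Y (ω j)) .of_discrete hc
  rw [hmean, hvar] at hcheb
  refine hcheb.trans (ENNReal.ofReal_le_ofReal ?_)
  rw [div_div]
  gcongr
  exact variance_le_expectation_sq .of_discrete

lemma choose_rpow_one_div_le (a : ℕ) {p : ℕ} (hp : p ≠ 0) :
    (a.choose p : ℝ) ^ (1 / (p : ℝ)) ≤ a := by
  rw [one_div, Real.rpow_inv_le_iff_of_pos (by positivity) (by positivity) (by positivity),
    Real.rpow_natCast]
  exact_mod_cast Nat.choose_le_pow a p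

lemma choose_sq_div_mul_rpow_le (a : ℕ) {p : ℕ} (hp : p ≠ 0) {S : ℝ} (hS : 0 < S)
    (h : (a.choose p : ℝ) ≤ S) :
    (a.choose p : ℝ) ^ 2 / a * S ^ (1 / (p : ℝ)) ≤ a.choose p * S := by
  rcases Nat.eq_zero_or_pos (a.choose p) with h0 | h0
  · simp [h0]
  have ha : (0 : ℝ) < a := by
    rcases Nat.eq_zero_or_pos a with rfl | ha
    · simp [Nat.choose_eq_zero_of_lt (Nat.pos_of_ne_zero hp)] at h0
    · exact_mod_cast ha
  have hroot := choose_rpow_one_div_le a hp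
  have hc : (0 : ℝ) < a.choose p := by exact_mod_cast h0
  have hp1 : 1 / (p : ℝ) ≤ 1 := by
    rw [div_le_one (by positivity)]
    exact_mod_cast Nat.one_le_iff_ne_zero.2 hp
  have hsplit (t : ℝ) (ht : 0 < t) : t = t ^ (1 / (p : ℝ)) * t ^ (1 - 1 / (p : ℝ)) := by
    rw [← Real.rpow_add ht]
    simp
  have key : (a.choose p : ℝ) * S ^ (1 / (p : ℝ)) ≤ a * S :=
    calc (a.choose p : ℝ) * S ^ (1 / (p : ℝ))
        = (a.choose p : ℝ) ^ (1 / (p : ℝ)) * (a.choose p : ℝ) ^ (1 - 1 / (p : ℝ))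
            * S ^ (1 / (p : ℝ)) := by rw [← hsplit _ hc]
      _ ≤ a * S ^ (1 - 1 / (p : ℝ)) * S ^ (1 / (p : ℝ)) := by
          gcongr
      _ = a * S := by rw [mul_assoc, mul_comm (S ^ _), ← hsplit _ hS]
  rw [div_mul_eq_mul_div, div_le_iff₀ ha]
  nlinarith

/-- Concentration half of Lemma 3.1. If `S_p/2 ≤ S̃ ≤ 6 S_p` and the number
of independent weighted samples satisfies `k ≥ 36 m / (ε² S̃^{1/p})`, then the sample mean
`Ȳ` of the unbiased estimator `Y` deviates from `S_p` by at least `ε S_p` with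
probability at most `1/3`. -/
theorem sample_mean_concentration (p n : ℕ) (hp : 2 ≤ p)
    (ε : ℝ) (hε0 : 0 < ε) (hε1 : ε ≤ 1 / 2)
    (x : Fin n → ℕ) (M : ℕ) (hM : M = ∑ i, x i) (hMpos : 0 < M)
    (m : ℝ) (hm : m = (M : ℝ) / 2)
    (Sp : ℕ) (hSp : Sp = ∑ i, (x i).choose p) (hSppos : 0 < Sp)
    (μ : Measure (Fin n)) [IsProbabilityMeasure μ]
    (hμ : ∀ i, μ {i} = ENNReal.ofReal ((x i : ℝ) / (M : ℝ)))
    (Y : Fin n → ℝ) (hY : ∀ i, Y i = ((M : ℝ) / (x i : ℝ)) * ((x i).choose p : ℝ))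
    (St : ℝ) (hSt1 : (Sp : ℝ) / 2 ≤ St) (hSt2 : St ≤ 6 * (Sp : ℝ))
    (k : ℕ) (hk : 0 < k)
    (hkk : (k : ℝ) ≥ 36 * m / (ε ^ 2 * St ^ ((1 : ℝ) / (p : ℝ)))) :
    (Measure.pi fun _ : Fin k => μ)
        {ω : Fin k → Fin n | ε * (Sp : ℝ) ≤ |(1 / (k : ℝ)) * ∑ j, Y (ω j) - (Sp : ℝ)|}
      ≤ 1 / 3 := by
  have hp0 : p ≠ 0 := by omega
  have hM' : (0 : ℝ) < M := Nat.cast_pos.2 hMpos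
  have hS : (0 : ℝ) < Sp := Nat.cast_pos.2 hSppos
  have hk' : (0 : ℝ) < k := Nat.cast_pos.2 hk
  have hSt : 0 < St := by linarith
  have hSsum : (Sp : ℝ) = ∑ i, ((x i).choose p : ℝ) := by
    rw [hSp]
    push_cast
    rfl
  have hμr (i : Fin n) : μ.real {i} = (x i : ℝ) / M := by
    rw [measureReal_def, hμ, ENNReal.toReal_ofReal (by positivity)]
  have hmean : ∫ i, Y i ∂μ = Sp := by
    rw [integral_fintype .of_finite, hSsum]
    refine Finset.sum_congr rfl fun i _ => ?_
    rw [hμr, hY, smul_eq_mul]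
    rcases Nat.eq_zero_or_pos (x i) with h | h
    · simp [h, Nat.choose_eq_zero_of_lt (Nat.pos_of_ne_zero hp0)]
    · field_simp
  have hsecond : ∫ i, Y i ^ 2 ∂μ = M * ∑ i, ((x i).choose p : ℝ) ^ 2 / x i := by
    rw [integral_fintype .of_finite, Finset.mul_sum]
    refine Finset.sum_congr rfl fun i _ => ?_
    rw [hμr, hY, smul_eq_mul]
    rcases Nat.eq_zero_or_pos (x i) with h | h
    · simp [h]
    · field_simp
  have hbound : (∫ i, Y i ^ 2 ∂μ) * (Sp : ℝ) ^ (1 / (p : ℝ)) ≤ M * (Sp : ℝ) ^ 2 := by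
    rw [hsecond, mul_assoc, Finset.sum_mul]
    gcongr
    calc ∑ i, ((x i).choose p : ℝ) ^ 2 / x i * (Sp : ℝ) ^ (1 / (p : ℝ))
        ≤ ∑ i, ((x i).choose p : ℝ) * Sp := by
          refine Finset.sum_le_sum fun i _ => choose_sq_div_mul_rpow_le _ hp0 hS ?_
          rw [hSsum]
          exact Finset.single_le_sum (f := fun i => ((x i).choose p : ℝ))
            (fun _ _ => by positivity) (Finset.mem_univ i)
      _ = (Sp : ℝ) ^ 2 := by rw [← Finset.sum_mul, ← hSsum, sq]
  have hroot : St ^ (1 / (p : ℝ)) ≤ 6 * (Sp : ℝ) ^ (1 / (p : ℝ)) := by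
    have h6 : (6 : ℝ) ^ (1 / (p : ℝ)) ≤ 6 := by
      refine Real.rpow_le_self_of_one_le (by norm_num) ?_
      rw [div_le_one (by positivity)]
      exact_mod_cast Nat.one_le_iff_ne_zero.2 hp0
    calc St ^ (1 / (p : ℝ)) ≤ (6 * (Sp : ℝ)) ^ (1 / (p : ℝ)) := by gcongr
      _ = 6 ^ (1 / (p : ℝ)) * (Sp : ℝ) ^ (1 / (p : ℝ)) :=
          Real.mul_rpow (by norm_num) hS.le
      _ ≤ 6 * (Sp : ℝ) ^ (1 / (p : ℝ)) := by gcongr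
  have hcheb := measure_pi_le_abs_sample_mean_sub_le μ Y hk (mul_pos hε0 hS)
  rw [hmean] at hcheb
  refine hcheb.trans ?_
  have hthird : (1 / 3 : ENNReal) = ENNReal.ofReal (1 / 3) := by
    rw [ENNReal.ofReal_div_of_pos (by norm_num)]
    simp
  rw [hthird]
  refine ENNReal.ofReal_le_ofReal ?_
  rw [div_le_iff₀ (by positivity)]
  have hkM : 18 * (M : ℝ) ≤ k * (ε ^ 2 * (6 * (Sp : ℝ) ^ (1 / (p : ℝ)))) := by
    have hle := (div_le_iff₀ (by positivity)).1 hkk.le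
    calc 18 * (M : ℝ) = 36 * m := by rw [hm]; ring
      _ ≤ k * (ε ^ 2 * St ^ (1 / (p : ℝ))) := hle
      _ ≤ _ := by gcongr
  have hR : 0 < (Sp : ℝ) ^ (1 / (p : ℝ)) := by positivity
  refine le_of_mul_le_mul_right ?_ hR
  have := mul_le_mul_of_nonneg_right hkM (sq_nonneg (Sp : ℝ))
  linarith
end

section
/- Let p ≥ 1 and n ≥ 1 be integers and let x_1, …, x_n be nonnegative integers. If Σ_{i=1}^n C(x_i, p) ≤ n, then Σ_{i=1}^n x_i ≤ n·p. -/
/-- The tangent-line bound for `x ↦ C(x, p)` at `x = p`. -/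
theorem Nat.succ_le_add_choose {p : ℕ} (hp : 1 ≤ p) (x : ℕ) : x + 1 ≤ p + x.choose p := by
  induction x with
  | zero => omega
  | succ x ih =>
    obtain ⟨q, rfl⟩ := Nat.exists_eq_add_of_le' hp
    rw [Nat.choose_succ_succ']
    rcases lt_or_ge x q with hx | hx
    · omega
    · have := Nat.choose_pos hx
      omega

/-- If `∑ C(x_i, p) ≤ n` then `∑ x_i ≤ n·p`
(if `p`-stars are rare then there are few edges). -/
theorem sum_le_of_choose_sum_le (p n : ℕ) (hp : 1 ≤ p) (hn : 1 ≤ n) (x : Fin n → ℕ)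
    (h : ∑ i, (x i).choose p ≤ n) : ∑ i, x i ≤ n * p := by
  have hsum : ∑ i, (x i + 1) ≤ ∑ i, (p + (x i).choose p) :=
    Finset.sum_le_sum fun i _ => Nat.succ_le_add_choose hp (x i)
  simp only [Finset.sum_add_distrib, Finset.sum_const, Finset.card_univ, Fintype.card_fin,
    smul_eq_mul, mul_one] at hsum
  omega
end

section
/- Let w_1, …, w_n be nonnegative real numbers. Then (Σ_{i=1}^n w_i)·(Σ_{i=1}^n w_i³) ≤ √n · (Σ_{i=1}^n w_i²)². -/
theorem Finset.sum_le_sqrt_card_mul_sqrt_sum_sq {ι : Type*} (s : Finset ι) (f : ι → ℝ) :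
    ∑ i ∈ s, f i ≤ √(s.card : ℝ) * √(∑ i ∈ s, f i ^ 2) := by
  rw [← Real.sqrt_mul (Nat.cast_nonneg _)]
  exact Real.le_sqrt_of_sq_le sq_sum_le_card_mul_sum_sq

theorem Finset.sum_cube_le_sqrt_mul_sum_sq {ι : Type*} (s : Finset ι) (f : ι → ℝ) :
    ∑ i ∈ s, f i ^ 3 ≤ √(∑ i ∈ s, f i ^ 2) * ∑ i ∈ s, f i ^ 2 := by
  rw [Finset.mul_sum]
  refine Finset.sum_le_sum fun i hi ↦ ?_
  have h : f i ≤ √(∑ j ∈ s, f j ^ 2) := Real.le_sqrt_of_sq_le <|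
    Finset.single_le_sum (f := fun j ↦ f j ^ 2) (fun j _ ↦ sq_nonneg (f j)) hi
  rw [pow_succ' (f i) 2]
  gcongr

/-- For nonnegative reals `w_1, …, w_n`,
`(∑ w_i) · (∑ w_i³) ≤ √n · (∑ w_i²)²`. -/
theorem sum_mul_sum_cube_le (n : ℕ) (w : Fin n → ℝ) (hw : ∀ i, 0 ≤ w i) :
    (∑ i, w i) * (∑ i, (w i) ^ 3) ≤ Real.sqrt n * (∑ i, (w i) ^ 2) ^ 2 := by
  have hS : 0 ≤ ∑ i, w i ^ 2 := Finset.sum_nonneg fun i _ ↦ sq_nonneg (w i)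
  have hlin : ∑ i, w i ≤ √(n : ℝ) * √(∑ i, w i ^ 2) := by
    simpa using Finset.sum_le_sqrt_card_mul_sqrt_sum_sq Finset.univ w
  calc (∑ i, w i) * ∑ i, w i ^ 3
      ≤ (√(n : ℝ) * √(∑ i, w i ^ 2)) * (√(∑ i, w i ^ 2) * ∑ i, w i ^ 2) :=
        mul_le_mul hlin (Finset.sum_cube_le_sqrt_mul_sum_sq Finset.univ w)
          (Finset.sum_nonneg fun i _ ↦ pow_nonneg (hw i) 3) (by positivity)
    _ = √(n : ℝ) * (√(∑ i, w i ^ 2) * √(∑ i, w i ^ 2)) * ∑ i, w i ^ 2 := by ring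
    _ = √(n : ℝ) * (∑ i, w i ^ 2) ^ 2 := by rw [Real.mul_self_sqrt hS]; ring
end
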